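/- arXiv:1901.00373 — 4 statements merged into one kernel-verified Lean document; each statement's English description precedes it below -/
import Mathlib

section
/- Irreducibility and aperiodicity of the kCD chain: for every 1 < k ≤ n, the transition kernel P_k satisfies P_k(S | S) > 0 for every network state S, and for all network states S, S' there exists m ≥ 1 such that the m-step transition probability (P_k)^m(S' | S) is strictly positive. -/
open Finset

namespace NEkSN

/-- A network state: a profile of binary actions together with a symmetric,
loopless adjacency matrix of friendship links. -/
abbrev NetState (n : ℕ) :=
  {S : (Fin n → Bool) × (Fin n → Fin n → Bool) //
    (∀ i j, S.2 i j = S.2 j i) ∧ ∀ i, S.2 i i = false}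

variable {n : ℕ}

noncomputable section

/-- The (real-valued) action of agent `i`. -/
def act (S : NetState n) (i : Fin n) : ℝ := if S.1.1 i then 1 else 0

/-- The (real-valued) link indicator between `i` and `j`. -/
def lnk (S : NetState n) (i j : Fin n) : ℝ := if S.1.2 i j then 1 else 0

/-- Agent `i`'s utility. -/
def util (v : Fin n → ℝ) (w : Fin n → Fin n → ℝ) (q : Fin n → Fin n → Fin n → ℝ)
    (h φ : ℝ) (i : Fin n) (S : NetState n) : ℝ :=
  act S i * v i
    + ∑ j ∈ univ.erase i, lnk S i j * w i j
    + ∑ j ∈ univ.erase i, ∑ k ∈ univ.erase i,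
        (if j < k then q i j k * lnk S i j * lnk S j k * lnk S k i else 0)
    + h * act S i * ∑ j ∈ univ.erase i, act S j
    + φ * ∑ j ∈ univ.erase i,
        lnk S i j * (act S i * act S j + (1 - act S i) * (1 - act S j))

/-- The potential function. -/
def potential (v : Fin n → ℝ) (w : Fin n → Fin n → ℝ) (q : Fin n → Fin n → Fin n → ℝ)
    (h φ : ℝ) (S : NetState n) : ℝ :=
  (∑ i, act S i * v i)
    + (1 / 2) * ∑ i, ∑ j ∈ univ.erase i, lnk S i j * w i j
    + (h / 2) * ∑ i, ∑ j ∈ univ.erase i, act S i * act S j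
    + (φ / 2) * ∑ i, ∑ j ∈ univ.erase i,
        lnk S i j * (act S i * act S j + (1 - act S i) * (1 - act S j))
    + ∑ i, ∑ j, ∑ k, (if i < j ∧ j < k then q i j k * lnk S i j * lnk S j k * lnk S k i else 0)

/-- The state `S` with `i`'s action set to `b`. -/
def setAct (S : NetState n) (i : Fin n) (b : Bool) : NetState n :=
  ⟨(Function.update S.1.1 i b, S.1.2), S.2⟩

/-- The state `S` with the link between `i` and `j` (`i ≠ j`) set to `b`. -/
def setLink (S : NetState n) (i j : Fin n) (b : Bool) : NetState n :=
  ⟨(S.1.1, fun p q =>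
      if p = q then false
      else if (p = i ∧ q = j) ∨ (p = j ∧ q = i) then b else S.1.2 p q), by
    refine ⟨fun p q => ?_, fun p => ?_⟩
    · by_cases hpq : p = q
      · simp [hpq]
      · have hqp : ¬q = p := fun hc => hpq hc.symm
        simp only [if_neg hpq, if_neg hqp]
        by_cases hc : (p = i ∧ q = j) ∨ (p = j ∧ q = i)
        · rw [if_pos hc, if_pos (by tauto)]
        · rw [if_neg hc, if_neg (by tauto), S.2.1 p q]
    · simp⟩

/-- The state `S` with all links between `i` and members of `D` deleted. -/
def deleteLinks (S : NetState n) (i : Fin n) (D : Finset (Fin n)) : NetState n :=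
  ⟨(S.1.1, fun p q => if (p = i ∧ q ∈ D) ∨ (q = i ∧ p ∈ D) then false else S.1.2 p q), by
    refine ⟨fun p q => ?_, fun p => ?_⟩
    · dsimp only
      by_cases hc : (p = i ∧ q ∈ D) ∨ (q = i ∧ p ∈ D)
      · rw [if_pos hc, if_pos (by tauto)]
      · rw [if_neg hc, if_neg (by tauto), S.2.1 p q]
    · dsimp only
      split
      · rfl
      · exact S.2.2 p⟩

/-- Incremental utility of agent `i` from switching her action on. -/
def dActU (v : Fin n → ℝ) (w : Fin n → Fin n → ℝ) (q : Fin n → Fin n → Fin n → ℝ)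
    (h φ : ℝ) (i : Fin n) (S : NetState n) : ℝ :=
  util v w q h φ i (setAct S i true) - util v w q h φ i (setAct S i false)

/-- Incremental potential from switching `i`'s action on. -/
def dActP (v : Fin n → ℝ) (w : Fin n → Fin n → ℝ) (q : Fin n → Fin n → Fin n → ℝ)
    (h φ : ℝ) (i : Fin n) (S : NetState n) : ℝ :=
  potential v w q h φ (setAct S i true) - potential v w q h φ (setAct S i false)

/-- Incremental utility of agent `i` from the link with `j`. -/
def dLinkU (v : Fin n → ℝ) (w : Fin n → Fin n → ℝ) (q : Fin n → Fin n → Fin n → ℝ)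
    (h φ : ℝ) (i j : Fin n) (S : NetState n) : ℝ :=
  util v w q h φ i (setLink S i j true) - util v w q h φ i (setLink S i j false)

/-- Incremental potential from the link between `i` and `j`. -/
def dLinkP (v : Fin n → ℝ) (w : Fin n → Fin n → ℝ) (q : Fin n → Fin n → Fin n → ℝ)
    (h φ : ℝ) (i j : Fin n) (S : NetState n) : ℝ :=
  potential v w q h φ (setLink S i j true) - potential v w q h φ (setLink S i j false)

/-- A `k`-meeting: an agent `i` together with a set of `k - 1` other agents. -/
abbrev Meeting (n k : ℕ) :=
  {μ : Fin n × Finset (Fin n) // μ.1 ∉ μ.2 ∧ μ.2.card = k - 1}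

/-- The `k`-neighborhood of `S` for meeting `μ = (i, I)`: all states agreeing with `S`
except possibly in `i`'s action and the links between `i` and members of `I`. -/
def nbhd {k : ℕ} (μ : Meeting n k) (S : NetState n) : Finset (NetState n) :=
  univ.filter fun S' =>
    (∀ p, p ≠ μ.1.1 → S'.1.1 p = S.1.1 p) ∧
    (∀ p q, ¬((p = μ.1.1 ∧ q ∈ μ.1.2) ∨ (q = μ.1.1 ∧ p ∈ μ.1.2)) → S'.1.2 p q = S.1.2 p q)

/-- The feasible set for the decision problem of `μ.1` on the neighborhood of `S`:
states in the neighborhood satisfying the stability constraints. -/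
def feasible (v : Fin n → ℝ) (w : Fin n → Fin n → ℝ) (q : Fin n → Fin n → Fin n → ℝ)
    (h φ : ℝ) {k : ℕ} (μ : Meeting n k) (S : NetState n) : Set (NetState n) :=
  {S' | S' ∈ nbhd μ S ∧
    ∀ j ∈ μ.1.2, S'.1.2 μ.1.1 j = true → 0 ≤ dLinkU v w q h φ j μ.1.1 S'}

/-- Nash equilibrium in a `k`(-player) stable network. -/
def isNEkSN (v : Fin n → ℝ) (w : Fin n → Fin n → ℝ) (q : Fin n → Fin n → Fin n → ℝ)
    (h φ : ℝ) (k : ℕ) (S : NetState n) : Prop :=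
  ∀ μ : Meeting n k,
    S ∈ feasible v w q h φ μ S ∧
    ∀ T ∈ feasible v w q h φ μ S, util v w q h φ μ.1.1 T ≤ util v w q h φ μ.1.1 S

/-- One-step transition kernel of the `k`-player consensual dynamic with logit shocks:
`kernel … ρ S' S = P_k(S' | S)`. -/
def kernel (v : Fin n → ℝ) (w : Fin n → Fin n → ℝ) (q : Fin n → Fin n → Fin n → ℝ)
    (h φ : ℝ) (k : ℕ) (ρ : Meeting n k → ℝ) (S' S : NetState n) : ℝ :=
  ∑ μ : Meeting n k,
    if S' ∈ nbhd μ S then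
      ρ μ * Real.exp (potential v w q h φ S') /
        ∑ T ∈ nbhd μ S, Real.exp (potential v w q h φ T)
    else 0

/-- The Gibbs (stationary) distribution `π(S) ∝ exp (Φ S)`. -/
def gibbs (v : Fin n → ℝ) (w : Fin n → Fin n → ℝ) (q : Fin n → Fin n → Fin n → ℝ)
    (h φ : ℝ) (S : NetState n) : ℝ :=
  Real.exp (potential v w q h φ S) / ∑ T : NetState n, Real.exp (potential v w q h φ T)

/-- `m`-step transition probabilities of the `k`CD. -/
def kernelIter (v : Fin n → ℝ) (w : Fin n → Fin n → ℝ) (q : Fin n → Fin n → Fin n → ℝ)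
    (h φ : ℝ) (k : ℕ) (ρ : Meeting n k → ℝ) : ℕ → NetState n → NetState n → ℝ
  | 0, S', S => if S' = S then 1 else 0
  | m + 1, S', S =>
      ∑ T : NetState n, kernel v w q h φ k ρ S' T * kernelIter v w q h φ k ρ m T S

/-- The eigenfunction `e_I` associated with a set `I` of coordinate pairs `(i, j)`, `i ≥ j`:
`(i, i)` refers to the action `a_i` and `(i, j)` with `i > j` to the link `g_{ij}`. -/
def eig (I : Finset (Fin n × Fin n)) (S : NetState n) : ℝ :=
  ∏ p ∈ I,
    if p.1 = p.2 then (if S.1.1 p.1 then (-1 : ℝ) else 1)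
    else (if S.1.2 p.1 p.2 then (-1 : ℝ) else 1)

/-- `I_i = {j ≠ i : (i, j) ∈ I or (j, i) ∈ I}`. -/
def linkedSet (I : Finset (Fin n × Fin n)) (i : Fin n) : Finset (Fin n) :=
  univ.filter fun j => j ≠ i ∧ ((i, j) ∈ I ∨ (j, i) ∈ I)

/-- The eigenvalue `λ_{k,I}`. -/
def lam (k : ℕ) (I : Finset (Fin n × Fin n)) : ℝ :=
  (∑ i ∈ univ.filter (fun i : Fin n => (i, i) ∉ I),
      ((n - 1 - (linkedSet I i).card).choose (k - 1) : ℝ))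
    / (n * ((n - 1).choose (k - 1) : ℝ))

/-- The one-flip neighborhood `N(S)`: states obtained from `S` by flipping exactly one
coordinate (one action or one link). -/
def flipNbhd (S : NetState n) : Set (NetState n) :=
  {S' | (∃ i, S' = setAct S i (!S.1.1 i)) ∨
        ∃ i j, i ≠ j ∧ S' = setLink S i j (!S.1.2 i j)}

end



theorem aux_kernel_pos {n : ℕ} (v : Fin n → ℝ) (w : Fin n → Fin n → ℝ)
    (q : Fin n → Fin n → Fin n → ℝ) (h φ : ℝ) (k : ℕ)
    (ρ : Meeting n k → ℝ) (hρpos : ∀ μ, 0 < ρ μ) (S' S : NetState n)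
    (hex : ∃ μ : Meeting n k, S' ∈ nbhd μ S) : 0 < kernel v w q h φ k ρ S' S := by
  obtain ⟨μ, hμ⟩ := hex
  unfold kernel
  refine Finset.sum_pos' (fun ν _ => ?_) ⟨μ, Finset.mem_univ _, ?_⟩
  · split_ifs
    · exact div_nonneg (mul_nonneg (hρpos ν).le (Real.exp_pos _).le)
        (Finset.sum_nonneg fun _ _ => (Real.exp_pos _).le)
    · exact le_rfl
  · rw [if_pos hμ]
    exact div_pos (mul_pos (hρpos μ) (Real.exp_pos _))
      (Finset.sum_pos (fun _ _ => Real.exp_pos _) ⟨S', hμ⟩)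

theorem aux_kernel_nonneg {n : ℕ} (v : Fin n → ℝ) (w : Fin n → Fin n → ℝ)
    (q : Fin n → Fin n → Fin n → ℝ) (h φ : ℝ) (k : ℕ)
    (ρ : Meeting n k → ℝ) (hρpos : ∀ μ, 0 < ρ μ) (S' S : NetState n) :
    0 ≤ kernel v w q h φ k ρ S' S := by
  unfold kernel
  refine Finset.sum_nonneg (fun ν _ => ?_)
  split_ifs
  · exact div_nonneg (mul_nonneg (hρpos ν).le (Real.exp_pos _).le)
      (Finset.sum_nonneg fun _ _ => (Real.exp_pos _).le)
  · exact le_rfl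

theorem aux_iter_nonneg {n : ℕ} (v : Fin n → ℝ) (w : Fin n → Fin n → ℝ)
    (q : Fin n → Fin n → Fin n → ℝ) (h φ : ℝ) (k : ℕ)
    (ρ : Meeting n k → ℝ) (hρpos : ∀ μ, 0 < ρ μ) (m : ℕ) (S' S : NetState n) :
    0 ≤ kernelIter v w q h φ k ρ m S' S := by
  induction m generalizing S' with
  | zero => unfold kernelIter; split_ifs <;> simp
  | succ m ih =>
    unfold kernelIter
    exact Finset.sum_nonneg fun T _ =>
      mul_nonneg (aux_kernel_nonneg v w q h φ k ρ hρpos _ _) (ih T)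

theorem aux_iter_step {n : ℕ} (v : Fin n → ℝ) (w : Fin n → Fin n → ℝ)
    (q : Fin n → Fin n → Fin n → ℝ) (h φ : ℝ) (k : ℕ)
    (ρ : Meeting n k → ℝ) (hρpos : ∀ μ, 0 < ρ μ) (m : ℕ) (S' T S : NetState n)
    (h1 : 0 < kernel v w q h φ k ρ S' T) (h2 : 0 < kernelIter v w q h φ k ρ m T S) :
    0 < kernelIter v w q h φ k ρ (m + 1) S' S := by
  unfold kernelIter
  exact Finset.sum_pos' (fun U _ => mul_nonneg (aux_kernel_nonneg v w q h φ k ρ hρpos _ _)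
    (aux_iter_nonneg v w q h φ k ρ hρpos m U S)) ⟨T, Finset.mem_univ _, mul_pos h1 h2⟩

/-- A meeting of `i` with a group containing a prescribed `j ≠ i`. -/
theorem aux_meeting {n k : ℕ} (hk1 : 1 < k) (hk2 : k ≤ n) (i j : Fin n) (hij : i ≠ j) :
    ∃ μ : Meeting n k, μ.1.1 = i ∧ j ∈ μ.1.2 := by
  obtain ⟨I, hI1, hI2, hI3⟩ := Finset.exists_subsuperset_card_eq
    (s := {j}) (t := Finset.univ.erase i) (n := k - 1)
    (by simpa using hij.symm) (by simp; omega) (by simp; omega)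
  refine ⟨⟨(i, I), fun hi => ?_, hI3⟩, rfl, hI1 (by simp)⟩
  have := hI2 hi
  simp at this

theorem aux_reach {n : ℕ} (hn : 2 ≤ n) {k : ℕ} (hk1 : 1 < k) (hk2 : k ≤ n) (S' : NetState n)
    (R : NetState n → NetState n → Prop)
    (hR : ∀ S T, (∃ μ : Meeting n k, T ∈ nbhd μ S) → R S T)
    (D : Finset (Fin n × Fin n)) : ∀ S : NetState n,
    (∀ i, (i, i) ∉ D → S.1.1 i = S'.1.1 i) →
    (∀ i j, (i, j) ∉ D → S.1.2 i j = S'.1.2 i j) →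
    Relation.ReflTransGen R S S' := by
  induction D using Finset.induction_on with
  | empty =>
    intro S h1 h2
    have : S = S' := by
      apply Subtype.ext
      apply Prod.ext
      · funext i; exact h1 i (by simp)
      · funext i j; exact h2 i j (by simp)
    rw [this]
  | insert p D hp ih =>
    intro S h1 h2
    obtain ⟨i, j⟩ := p
    by_cases hij : i = j
    · subst hij
      refine Relation.ReflTransGen.head (b := setAct S i (S'.1.1 i)) (hR _ _ ?_) (ih _ ?_ ?_)
      · have : Nontrivial (Fin n) := Fin.nontrivial_iff_two_le.2 hn
        obtain ⟨j, hj⟩ := exists_ne i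
        obtain ⟨μ, hμ, -⟩ := aux_meeting hk1 hk2 i j hj.symm
        refine ⟨μ, ?_⟩
        simp only [nbhd, Finset.mem_filter, Finset.mem_univ, true_and, setAct, hμ]
        exact ⟨fun p hp => Function.update_of_ne hp _ _, by simp⟩
      · intro l hl
        by_cases hli : l = i
        · subst hli; simp [setAct]
        · simp only [setAct, Function.update_of_ne hli]
          exact h1 l (by simp [hli, hl])
      · intro a b hab
        by_cases hc : a = i ∧ b = i
        · obtain ⟨rfl, rfl⟩ := hc
          simp [setAct, S.2.2, S'.2.2]
        · exact h2 a b (by simp only [Finset.mem_insert, Prod.mk.injEq]; tauto)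
    · refine Relation.ReflTransGen.head (b := setLink S i j (S'.1.2 i j)) (hR _ _ ?_) (ih _ ?_ ?_)
      · obtain ⟨μ, hμ, hj⟩ := aux_meeting hk1 hk2 i j hij
        refine ⟨μ, ?_⟩
        simp only [nbhd, Finset.mem_filter, Finset.mem_univ, true_and, setLink, hμ]
        refine ⟨by simp, fun a b hab => ?_⟩
        by_cases e : a = b
        · subst e; simp [S.2.2]
        · rw [if_neg e, if_neg]
          rintro (⟨rfl, rfl⟩ | ⟨rfl, rfl⟩) <;> exact hab (by tauto)
      · intro l hl
        refine h1 l ?_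
        simp only [Finset.mem_insert, Prod.mk.injEq, not_or]
        exact ⟨fun hc => hij (hc.1.symm.trans hc.2), hl⟩
      · intro a b hab
        simp only [setLink]
        split_ifs with e c
        · subst e; exact (S'.2.2 a).symm
        · rcases c with ⟨rfl, rfl⟩ | ⟨rfl, rfl⟩
          · rfl
          · exact S'.2.1 _ _
        · exact h2 a b (by simp only [Finset.mem_insert, Prod.mk.injEq]; tauto)

/-- the `k`CD chain is aperiodic (`P_k(S|S) > 0`) and irreducible (for all
`S, S'` some `m`-step transition probability is positive). -/
theorem kcd_aperiodic_irreducible {n : ℕ} (hn : 2 ≤ n)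
    (v : Fin n → ℝ) (w : Fin n → Fin n → ℝ) (hw : ∀ i j, w i j = w j i)
    (q : Fin n → Fin n → Fin n → ℝ)
    (hq1 : ∀ i j k, q i j k = q j i k) (hq2 : ∀ i j k, q i j k = q i k j)
    (h φ : ℝ) (k : ℕ) (hk1 : 1 < k) (hk2 : k ≤ n)
    (ρ : Meeting n k → ℝ) (hρpos : ∀ μ, 0 < ρ μ) (hρsum : ∑ μ : Meeting n k, ρ μ = 1) :
    (∀ S : NetState n, 0 < kernel v w q h φ k ρ S S) ∧
    (∀ S S' : NetState n, ∃ m : ℕ, 1 ≤ m ∧ 0 < kernelIter v w q h φ k ρ m S' S) := by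
  have hself : ∀ S : NetState n, 0 < kernel v w q h φ k ρ S S := by
    intro S
    apply aux_kernel_pos v w q h φ k ρ hρpos
    obtain ⟨μ, -⟩ := aux_meeting hk1 hk2 (⟨0, by omega⟩ : Fin n) ⟨1, by omega⟩ (by simp)
    exact ⟨μ, by simp [nbhd]⟩
  refine ⟨hself, fun S S' => ?_⟩
  have hreach := aux_reach hn hk1 hk2 S' (fun S T => 0 < kernel v w q h φ k ρ T S)
    (fun S T hex => aux_kernel_pos v w q h φ k ρ hρpos T S hex) Finset.univ S
    (by simp) (by simp)
  induction hreach with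
  | refl =>
    exact ⟨1, le_rfl, aux_iter_step v w q h φ k ρ hρpos 0 S S S (hself S) (by simp [kernelIter])⟩
  | tail _ hstep ih =>
    obtain ⟨m, _, hm⟩ := ih
    exact ⟨m + 1, by omega, aux_iter_step v w q h φ k ρ hρpos m _ _ S hstep hm⟩


end NEkSN
end

section
/- Uniqueness of the stationary distribution (Theorem 1, part 1): for every 1 < k ≤ n, the Gibbs distribution π(S) = exp(Φ(S)) / Σ_{Ŝ ∈ 𝒮ₙ} exp(Φ(Ŝ)) is the unique stationary distribution of the kCD kernel: if p : 𝒮ₙ → ℝ satisfies p(S) ≥ 0 for all S, Σ_{S} p(S) = 1, and Σ_{S} p(S) P_k(S' | S) = p(S') for all S', then p = π. -/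
open Finset

namespace NEkSN

variable {n : ℕ}

section Helpers

lemma mem_nbhd' {n k : ℕ} (μ : Meeting n k) (S S' : NetState n) :
    S' ∈ nbhd μ S ↔ (∀ p, p ≠ μ.1.1 → S'.1.1 p = S.1.1 p) ∧
    (∀ p q, ¬((p = μ.1.1 ∧ q ∈ μ.1.2) ∨ (q = μ.1.1 ∧ p ∈ μ.1.2)) → S'.1.2 p q = S.1.2 p q) := by
  simp only [nbhd, mem_filter, mem_univ, true_and]

lemma self_mem_nbhd {n k : ℕ} (μ : Meeting n k) (S : NetState n) : S ∈ nbhd μ S :=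
  (mem_nbhd' μ S S).2 ⟨fun _ _ => rfl, fun _ _ _ => rfl⟩

lemma nbhd_symm {n k : ℕ} (μ : Meeting n k) {S S' : NetState n} (hS : S' ∈ nbhd μ S) :
    S ∈ nbhd μ S' := by
  rw [mem_nbhd'] at hS ⊢
  exact ⟨fun p hp => (hS.1 p hp).symm, fun p q hp => (hS.2 p q hp).symm⟩

lemma nbhd_eq {n k : ℕ} (μ : Meeting n k) {S S' : NetState n} (hS : S' ∈ nbhd μ S) :
    nbhd μ S' = nbhd μ S := by
  ext T
  rw [mem_nbhd'] at hS
  rw [mem_nbhd', mem_nbhd']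
  constructor
  · rintro ⟨h1, h2⟩
    exact ⟨fun p hp => (h1 p hp).trans (hS.1 p hp), fun p q hp => (h2 p q hp).trans (hS.2 p q hp)⟩
  · rintro ⟨h1, h2⟩
    exact ⟨fun p hp => (h1 p hp).trans (hS.1 p hp).symm,
      fun p q hp => (h2 p q hp).trans (hS.2 p q hp).symm⟩

lemma exists_meeting {n k : ℕ} (hk1 : 1 < k) (hk2 : k ≤ n) (i j : Fin n) (hij : j ≠ i) :
    ∃ μ : Meeting n k, μ.1.1 = i ∧ j ∈ μ.1.2 := by
  obtain ⟨I, h1, h2, h3⟩ := Finset.exists_subsuperset_card_eq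
    (s := {j}) (t := univ.erase i) (n := k - 1) (by simpa using hij) (by simp; omega)
    (by rw [card_erase_of_mem (mem_univ i), card_univ, Fintype.card_fin]; omega)
  exact ⟨⟨(i, I), fun hi => by simpa using h2 hi, h3⟩, rfl, h1 (by simp)⟩

/-- Actions of `T` on `s`, the rest from `S`. -/
def mixAct {n : ℕ} (S T : NetState n) (s : Finset (Fin n)) : NetState n :=
  ⟨(fun i => if i ∈ s then T.1.1 i else S.1.1 i, S.1.2), S.2⟩

/-- Actions of `T`, links of `T` on `E`, remaining links from `S`. -/
def mixLink {n : ℕ} (S T : NetState n) (E : Finset (Fin n × Fin n)) : NetState n :=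
  ⟨(T.1.1, fun p q => if (p, q) ∈ E ∨ (q, p) ∈ E then T.1.2 p q else S.1.2 p q), by
    refine ⟨fun p q => ?_, fun p => ?_⟩
    · simp only [or_comm, T.2.1 p q, S.2.1 p q]
    · simp only [T.2.2 p, S.2.2 p, ite_self]⟩

lemma closed_univ {n k : ℕ} (hk1 : 1 < k) (hk2 : k ≤ n) (A : NetState n → Prop)
    (hA : ∀ S, A S → ∀ μ : Meeting n k, ∀ T ∈ nbhd μ S, A T) (S T : NetState n) (hS : A S) :
    A T := by
  have hex : ∀ i : Fin n, ∃ j, j ≠ i := fun i => by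
    haveI : Nontrivial (Fin n) := Fin.nontrivial_iff_two_le.2 (by omega)
    exact exists_ne i
  have h1 : ∀ s, A (mixAct S T s) := by
    intro s
    induction s using Finset.induction_on with
    | empty =>
      have : mixAct S T ∅ = S := by
        apply Subtype.ext; simp [mixAct]
      rwa [this]
    | insert i s his ih =>
      obtain ⟨j, hj⟩ := hex i
      obtain ⟨μ, hμ, -⟩ := exists_meeting hk1 hk2 i j hj
      refine hA _ ih μ _ ((mem_nbhd' _ _ _).2 ⟨fun p hp => ?_, fun p q _ => rfl⟩)
      rw [hμ] at hp
      simp [mixAct, hp]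
  have h2 : ∀ E, A (mixLink S T E) := by
    intro E
    induction E using Finset.induction_on with
    | empty =>
      have : mixLink S T ∅ = mixAct S T univ := by
        apply Subtype.ext; simp [mixLink, mixAct]
      rw [this]; exact h1 _
    | insert e E he ih =>
      obtain ⟨i, j⟩ := e
      by_cases hij : j = i
      · subst hij
        have : mixLink S T (insert (j, j) E) = mixLink S T E := by
          apply Subtype.ext
          refine Prod.ext rfl ?_
          funext p q
          by_cases hpq : p = q
          · subst hpq
            rw [(mixLink S T _).2.2, (mixLink S T _).2.2]
          · have a1 : ¬ (p = j ∧ q = j) := fun hc => hpq (hc.1.trans hc.2.symm)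
            have a2 : ¬ (q = j ∧ p = j) := fun hc => hpq (hc.2.trans hc.1.symm)
            simp [mixLink, a1, a2]
        rwa [this]
      · obtain ⟨μ, hμ, hjμ⟩ := exists_meeting hk1 hk2 i j hij
        refine hA _ ih μ _ ((mem_nbhd' _ _ _).2 ⟨fun p hp => rfl, fun p q hpq => ?_⟩)
        rw [hμ] at hpq
        have a1 : ¬ (p = i ∧ q = j) := fun hc => hpq (Or.inl ⟨hc.1, hc.2 ▸ hjμ⟩)
        have a2 : ¬ (q = i ∧ p = j) := fun hc => hpq (Or.inr ⟨hc.1, hc.2 ▸ hjμ⟩)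
        simp [mixLink, a1, a2]
  have : mixLink S T univ = T := by
    apply Subtype.ext; simp [mixLink]
  rw [← this]; exact h2 _

/-- Abstract maximum principle for the heat-bath dynamic. -/
lemma ratio_max {n k : ℕ} (e : NetState n → ℝ) (he : ∀ S, 0 < e S)
    (ρ : Meeting n k → ℝ) (hρpos : ∀ μ, 0 < ρ μ) (hρsum : ∑ μ : Meeting n k, ρ μ = 1)
    (p : NetState n → ℝ)
    (hstat : ∀ S' : NetState n,
      ∑ S : NetState n, p S * (∑ μ : Meeting n k,
        if S' ∈ nbhd μ S then ρ μ * e S' / ∑ T ∈ nbhd μ S, e T else 0) = p S')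
    (c : ℝ) (hc : ∀ S, p S ≤ c * e S) (S' : NetState n) (hS' : p S' = c * e S')
    (μ : Meeting n k) (T : NetState n) (hT : T ∈ nbhd μ S') : p T = c * e T := by
  have hZ : ∀ (μ : Meeting n k) S, 0 < ∑ T ∈ nbhd μ S, e T := fun μ S =>
    Finset.sum_pos (fun T _ => he T) ⟨S, self_mem_nbhd μ S⟩
  have key : p S' = ∑ μ : Meeting n k,
      ρ μ * e S' / (∑ T ∈ nbhd μ S', e T) * ∑ S ∈ nbhd μ S', p S := by
    rw [← hstat S']
    simp_rw [Finset.mul_sum]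
    rw [Finset.sum_comm]
    refine Finset.sum_congr rfl fun μ _ => ?_
    rw [← Finset.sum_subset (Finset.subset_univ (nbhd μ S'))]
    · refine Finset.sum_congr rfl fun S hS => ?_
      rw [if_pos (nbhd_symm μ hS), nbhd_eq μ hS, mul_comm]
    · intro S _ hS
      rw [if_neg fun hx => hS (nbhd_symm μ hx), mul_zero]
  have key2 : ∑ μ : Meeting n k,
      ρ μ * e S' / (∑ T ∈ nbhd μ S', e T) * ∑ S ∈ nbhd μ S', (c * e S - p S) = 0 := by
    simp_rw [Finset.sum_sub_distrib, mul_sub]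
    rw [Finset.sum_sub_distrib, ← key, hS', sub_eq_zero]
    have : ∀ μ : Meeting n k, ρ μ * e S' / (∑ T ∈ nbhd μ S', e T) * ∑ S ∈ nbhd μ S', c * e S
        = ρ μ * (c * e S') := fun μ => by
      rw [← Finset.mul_sum]
      have := (hZ μ S').ne'
      field_simp
    simp_rw [this]
    rw [← Finset.sum_mul, hρsum, one_mul]
  have hcoef : ∀ μ : Meeting n k, 0 < ρ μ * e S' / (∑ T ∈ nbhd μ S', e T) := fun μ =>
    div_pos (mul_pos (hρpos μ) (he S')) (hZ μ S')
  have hnn : ∀ μ : Meeting n k, 0 ≤ ∑ S ∈ nbhd μ S', (c * e S - p S) := fun μ =>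
    Finset.sum_nonneg fun S _ => sub_nonneg.2 (hc S)
  have h3 := (Finset.sum_eq_zero_iff_of_nonneg
    (fun μ _ => mul_nonneg (hcoef μ).le (hnn μ))).1 key2 μ (mem_univ μ)
  have h4 := (mul_eq_zero.1 h3).resolve_left (hcoef μ).ne'
  have h5 := (Finset.sum_eq_zero_iff_of_nonneg
    (fun S _ => sub_nonneg.2 (hc S))).1 h4 T hT
  linarith

end Helpers

/-- Theorem 1, part 1: the Gibbs distribution is the unique stationary
distribution of the `k`CD kernel. -/
theorem stationary_unique {n : ℕ} (hn : 2 ≤ n)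
    (v : Fin n → ℝ) (w : Fin n → Fin n → ℝ) (hw : ∀ i j, w i j = w j i)
    (q : Fin n → Fin n → Fin n → ℝ)
    (hq1 : ∀ i j k, q i j k = q j i k) (hq2 : ∀ i j k, q i j k = q i k j)
    (h φ : ℝ) (k : ℕ) (hk1 : 1 < k) (hk2 : k ≤ n)
    (ρ : Meeting n k → ℝ) (hρpos : ∀ μ, 0 < ρ μ) (hρsum : ∑ μ : Meeting n k, ρ μ = 1)
    (p : NetState n → ℝ) (hp0 : ∀ S, 0 ≤ p S) (hp1 : ∑ S : NetState n, p S = 1)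
    (hstat : ∀ S' : NetState n,
      ∑ S : NetState n, p S * kernel v w q h φ k ρ S' S = p S') :
    p = gibbs v w q h φ := by
  set e : NetState n → ℝ := fun S => Real.exp (potential v w q h φ S) with he_def
  have he : ∀ S, 0 < e S := fun S => Real.exp_pos _
  haveI : Nonempty (NetState n) :=
    ⟨⟨(fun _ => false, fun _ _ => false), fun _ _ => rfl, fun _ => rfl⟩⟩
  obtain ⟨S₀, hS₀⟩ := Finite.exists_max (fun S => p S / e S)
  have hc : ∀ S, p S ≤ (p S₀ / e S₀) * e S := fun S => (div_le_iff₀ (he S)).1 (hS₀ S)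
  have hall : ∀ T, p T = (p S₀ / e S₀) * e T := fun T =>
    closed_univ hk1 hk2 (fun T => p T = (p S₀ / e S₀) * e T)
      (fun S hS μ T hT => ratio_max e he ρ hρpos hρsum p hstat _ hc S hS μ T hT) S₀ T
      (div_mul_cancel₀ _ (he S₀).ne').symm
  have hsum : (p S₀ / e S₀) * ∑ T, e T = 1 := by
    rw [Finset.mul_sum, ← hp1]
    exact Finset.sum_congr rfl fun T _ => (hall T).symm
  have hpos : 0 < ∑ T, e T := Finset.sum_pos (fun T _ => he T) Finset.univ_nonempty
  funext S
  change p S = e S / ∑ T, e T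
  rw [hall S, eq_div_iff hpos.ne']
  linear_combination e S * hsum

end NEkSN
end

section
/- Eigenfunction equation (appendix lemma, part ii): suppose the potential Φ is constant on 𝒮ₙ and the meeting distribution is uniform, ρ(μ) = 1/(n · C(n−1, k−1)) for every k-meeting μ. Then for every set I of coordinate pairs and every network state S, Σ_{S'} P_k(S' | S) · e_I(S') = λ_{k,I} · e_I(S), where λ_{k,I} = (Σ_{i : (i,i) ∉ I} C(n − 1 − |I_i|, k − 1)) / (n · C(n − 1, k − 1)) and I_i = {j ≠ i : (i, j) ∈ I or (j, i) ∈ I}. -/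
open Finset

namespace NEkSN

variable {n : ℕ}

theorem sum_eq_zero_of_flip {α : Type*} (s : Finset α) (f : α → ℝ) (σ : α → α)
    (hs : ∀ x ∈ s, σ x ∈ s) (hinv : ∀ x, σ (σ x) = x) (hf : ∀ x, f (σ x) = - f x) :
    ∑ x ∈ s, f x = 0 := by
  have h1 : ∑ x ∈ s, f x = ∑ x ∈ s, f (σ x) :=
    Finset.sum_bij' (fun x _ => σ x) (fun x _ => σ x) hs hs
      (fun x _ => hinv x) (fun x _ => hinv x) (fun x _ => by rw [hinv])
  simp only [hf, Finset.sum_neg_distrib] at h1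
  linarith

theorem eig_flip (I : Finset (Fin n × Fin n)) (S T : NetState n) (p : Fin n × Fin n) (hp : p ∈ I)
    (h1 : (if p.1 = p.2 then (if T.1.1 p.1 then (-1 : ℝ) else 1)
      else (if T.1.2 p.1 p.2 then (-1 : ℝ) else 1)) =
      - (if p.1 = p.2 then (if S.1.1 p.1 then (-1 : ℝ) else 1)
      else (if S.1.2 p.1 p.2 then (-1 : ℝ) else 1)))
    (h2 : ∀ r ∈ I, r ≠ p → (r.1 = r.2 → T.1.1 r.1 = S.1.1 r.1) ∧
      (r.1 ≠ r.2 → T.1.2 r.1 r.2 = S.1.2 r.1 r.2)) :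
    eig I T = - eig I S := by
  unfold eig
  rw [← Finset.mul_prod_erase I _ hp, ← Finset.mul_prod_erase I _ hp, h1, neg_mul]
  congr 2
  refine Finset.prod_congr rfl fun r hr => ?_
  obtain ⟨ha, hb⟩ := h2 r (Finset.mem_of_mem_erase hr) (Finset.ne_of_mem_erase hr)
  by_cases h : r.1 = r.2
  · simp only [if_pos h, ha h]
  · simp only [if_neg h, hb h]

theorem sum_nbhd_act {k : ℕ} (μ : Meeting n k) (S : NetState n) (I : Finset (Fin n × Fin n))
    (hi : (μ.1.1, μ.1.1) ∈ I) : ∑ T ∈ nbhd μ S, eig I T = 0 := by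
  refine sum_eq_zero_of_flip _ _ (fun T => setAct T μ.1.1 (!T.1.1 μ.1.1)) ?_ ?_ ?_
  · intro T hT
    simp only [nbhd, Finset.mem_filter, Finset.mem_univ, true_and] at hT ⊢
    refine ⟨fun p hp => ?_, hT.2⟩
    simp only [setAct, Function.update_of_ne hp]
    exact hT.1 p hp
  · intro T
    simp [setAct]
  · intro T
    refine eig_flip I _ _ _ hi ?_ ?_
    · simp only [setAct, if_true, Function.update_self]
      cases T.1.1 μ.1.1 <;> simp
    · intro r _ hne
      refine ⟨fun h => ?_, fun _ => rfl⟩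
      have : r.1 ≠ μ.1.1 := fun hc => hne (Prod.ext hc (h ▸ hc))
      simp only [setAct, Function.update_of_ne this]

theorem sum_nbhd_link {k : ℕ} (μ : Meeting n k) (S : NetState n) (I : Finset (Fin n × Fin n))
    (hI : ∀ p ∈ I, p.2 ≤ p.1) (j : Fin n) (hj : j ∈ μ.1.2) (hl : j ∈ linkedSet I μ.1.1) :
    ∑ T ∈ nbhd μ S, eig I T = 0 := by
  obtain ⟨⟨i, J⟩, hμ⟩ := μ
  simp only [linkedSet, Finset.mem_filter, Finset.mem_univ, true_and] at hl hj
  obtain ⟨hji, hl⟩ := hl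
  refine sum_eq_zero_of_flip _ _ (fun T => setLink T i j (!T.1.2 i j)) ?_ ?_ ?_
  · intro T hT
    simp only [nbhd, Finset.mem_filter, Finset.mem_univ, true_and] at hT ⊢
    refine ⟨hT.1, fun p q hpq => ?_⟩
    rw [← hT.2 p q hpq]
    simp only [setLink]
    split_ifs with h1 h2
    · rw [h1, T.2.2]
    · exfalso; grind
    · rfl
  · intro T
    apply Subtype.ext
    refine Prod.ext rfl ?_
    funext p q
    have h1 := T.2.1 i j
    have h2 := T.2.2 p
    simp only [setLink, if_neg hji.symm, true_and, and_self, true_or, if_true, Bool.not_not]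
    grind
  · intro T
    have key : ∃ p ∈ I, p = (i, j) ∨ p = (j, i) := by
      rcases hl with h | h
      · exact ⟨_, h, Or.inl rfl⟩
      · exact ⟨_, h, Or.inr rfl⟩
    obtain ⟨p, hp, hpe⟩ := key
    have hsym := T.2.1 i j
    refine eig_flip I _ _ p hp ?_ ?_
    · rcases hpe with rfl | rfl
      · simp only [setLink, if_neg hji.symm]
        cases T.1.2 i j <;> simp
      · simp only [setLink, if_neg hji, ← hsym]
        cases T.1.2 i j <;> simp
    · intro r hr hne
      refine ⟨fun _ => rfl, fun h => ?_⟩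
      have hr' := hI r hr
      have hp' := hI p hp
      simp only [setLink, if_neg h]
      rw [if_neg]
      rintro (⟨h1, h2⟩ | ⟨h1, h2⟩)
      · rcases hpe with rfl | rfl
        · exact hne (Prod.ext h1 h2)
        · rw [h1, h2] at hr'; exact hji (le_antisymm hr' hp')
      · rcases hpe with rfl | rfl
        · rw [h1, h2] at hr'; exact hji (le_antisymm hp' hr')
        · exact hne (Prod.ext h1 h2)

theorem sum_nbhd_free {k : ℕ} (μ : Meeting n k) (S : NetState n) (I : Finset (Fin n × Fin n))
    (hi : (μ.1.1, μ.1.1) ∉ I) (hd : ∀ j ∈ μ.1.2, j ∉ linkedSet I μ.1.1) :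
    ∑ T ∈ nbhd μ S, eig I T = (nbhd μ S).card * eig I S := by
  rw [← nsmul_eq_mul]
  refine Finset.sum_eq_card_nsmul fun T hT => ?_
  obtain ⟨⟨i, J⟩, hμ⟩ := μ
  simp only [nbhd, linkedSet, Finset.mem_filter, Finset.mem_univ, true_and] at hT hi hd
  refine Finset.prod_congr rfl fun r hr => ?_
  obtain ⟨a, b⟩ := r
  by_cases h : a = b
  · simp only [if_pos h]
    rw [hT.1 a (by rintro rfl; subst h; exact hi hr)]
  · simp only [if_neg h]
    rw [hT.2 a b]
    rintro (⟨rfl, h2⟩ | ⟨rfl, h2⟩)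
    · exact hd b h2 ⟨Ne.symm h, Or.inl hr⟩
    · exact hd a h2 ⟨h, Or.inr hr⟩

theorem card_meetings (k : ℕ) (I : Finset (Fin n × Fin n)) :
    ((univ.filter fun μ : Meeting n k =>
      (μ.1.1, μ.1.1) ∉ I ∧ ∀ j ∈ μ.1.2, j ∉ linkedSet I μ.1.1).card) =
    ∑ i ∈ univ.filter (fun i : Fin n => (i, i) ∉ I),
      (n - 1 - (linkedSet I i).card).choose (k - 1) := by
  have h1 : ∀ i : Fin n, (n - 1 - (linkedSet I i).card).choose (k - 1) =
      (((univ.erase i) \ linkedSet I i).powersetCard (k - 1)).card := by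
    intro i
    rw [Finset.card_powersetCard, Finset.card_sdiff_of_subset, Finset.card_erase_of_mem (mem_univ i),
      Finset.card_univ, Fintype.card_fin]
    intro j hj
    simp only [linkedSet, Finset.mem_filter] at hj
    simp [hj.2.1]
  simp only [h1]
  rw [← Finset.card_sigma]
  refine Finset.card_bij' (fun μ _ => ⟨μ.1.1, μ.1.2⟩)
    (fun x hx => ⟨(x.1, x.2), ?_⟩) ?_ ?_ ?_ ?_
  · simp only [Finset.mem_sigma, Finset.mem_filter, Finset.mem_powersetCard] at hx
    refine ⟨fun hc => ?_, hx.2.2⟩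
    have := hx.2.1 hc
    simp at this
  · rintro ⟨⟨i, J⟩, hμ⟩ h
    simp only [Finset.mem_filter, Finset.mem_univ, true_and] at h
    simp only [Finset.mem_sigma, Finset.mem_filter, Finset.mem_powersetCard, Finset.mem_univ,
      true_and]
    refine ⟨h.1, fun j hj => ?_, hμ.2⟩
    simp only [Finset.mem_sdiff, Finset.mem_erase, Finset.mem_univ, and_true]
    exact ⟨fun hc => hμ.1 (hc ▸ hj), h.2 j hj⟩
  · rintro ⟨i, J⟩ hx
    simp only [Finset.mem_sigma, Finset.mem_filter, Finset.mem_powersetCard, Finset.mem_univ,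
      true_and] at hx
    simp only [Finset.mem_filter, Finset.mem_univ, true_and]
    exact ⟨hx.1, fun j hj => (Finset.mem_sdiff.1 (hx.2.1 hj)).2⟩
  · intro _ _; rfl
  · intro _ _; rfl

/-- appendix lemma, part ii: when the potential is constant and meetings
are uniform, each `e_I` is an eigenfunction of the `k`CD kernel with eigenvalue `λ_{k,I}`. -/
theorem eig_eigenfunction {n : ℕ} (hn : 2 ≤ n)
    (v : Fin n → ℝ) (w : Fin n → Fin n → ℝ) (hw : ∀ i j, w i j = w j i)
    (q : Fin n → Fin n → Fin n → ℝ)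
    (hq1 : ∀ i j k, q i j k = q j i k) (hq2 : ∀ i j k, q i j k = q i k j)
    (h φ : ℝ) (k : ℕ) (hk1 : 1 < k) (hk2 : k ≤ n)
    (hconst : ∀ S T : NetState n, potential v w q h φ S = potential v w q h φ T)
    (ρ : Meeting n k → ℝ)
    (hρ : ∀ μ : Meeting n k, ρ μ = 1 / (n * ((n - 1).choose (k - 1) : ℝ)))
    (I : Finset (Fin n × Fin n)) (hI : ∀ p ∈ I, p.2 ≤ p.1) (S : NetState n) :
    ∑ S' : NetState n, kernel v w q h φ k ρ S' S * eig I S' = lam k I * eig I S := by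
  have hmem : ∀ μ : Meeting n k, S ∈ nbhd μ S := fun μ => by simp [nbhd]
  have hterm : ∀ μ : Meeting n k, ∑ S' : NetState n,
      (if S' ∈ nbhd μ S then ρ μ * Real.exp (potential v w q h φ S') /
        ∑ T ∈ nbhd μ S, Real.exp (potential v w q h φ T) else 0) * eig I S' =
      if (μ.1.1, μ.1.1) ∉ I ∧ ∀ j ∈ μ.1.2, j ∉ linkedSet I μ.1.1 then
        1 / (n * ((n - 1).choose (k - 1) : ℝ)) * eig I S else 0 := by
    intro μ
    have hc : ((nbhd μ S).card : ℝ) ≠ 0 := by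
      exact_mod_cast (Finset.card_pos.2 ⟨S, hmem μ⟩).ne'
    have he := Real.exp_ne_zero (potential v w q h φ S)
    have e1 : ∑ S' : NetState n,
      (if S' ∈ nbhd μ S then ρ μ * Real.exp (potential v w q h φ S') /
        ∑ T ∈ nbhd μ S, Real.exp (potential v w q h φ T) else 0) * eig I S' =
        ρ μ / (nbhd μ S).card * ∑ T ∈ nbhd μ S, eig I T := by
      simp only [ite_mul, zero_mul, Finset.sum_ite_mem, Finset.univ_inter]
      rw [Finset.mul_sum]
      refine Finset.sum_congr rfl fun T _ => ?_
      simp only [fun T => hconst T S, Finset.sum_const, nsmul_eq_mul]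
      field_simp
    rw [e1]
    split_ifs with hcond
    · rw [sum_nbhd_free μ S I hcond.1 hcond.2, hρ]
      rw [← mul_assoc, div_mul_cancel₀ _ hc]
    · have : ∑ T ∈ nbhd μ S, eig I T = 0 := by
        by_cases hi : (μ.1.1, μ.1.1) ∈ I
        · exact sum_nbhd_act μ S I hi
        · have : ∃ j ∈ μ.1.2, j ∈ linkedSet I μ.1.1 := by
            by_contra hno
            push Not at hno
            exact hcond ⟨hi, hno⟩
          obtain ⟨j, hj, hl⟩ := this
          exact sum_nbhd_link μ S I hI j hj hl
      rw [this, mul_zero]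
  simp only [kernel, Finset.sum_mul]
  rw [Finset.sum_comm]
  simp only [hterm]
  rw [← Finset.sum_filter, Finset.sum_const, card_meetings, nsmul_eq_mul, lam]
  push_cast
  ring

end NEkSN
end

section
/- Monotonicity of the eigenvalues: with λ_{k,I} = (Σ_{i : (i,i) ∉ I} C(n − 1 − |I_i|, k − 1)) / (n · C(n − 1, k − 1)) and I_i = {j ≠ i : (i, j) ∈ I or (j, i) ∈ I}, one has λ_{k,∅} = 1, 0 ≤ λ_{k,I} ≤ 1 for every I, and λ_{k,I'} ≤ λ_{k,I} whenever I ⊆ I'; moreover for fixed I, λ_{k,I} is weakly decreasing in k on 2 ≤ k ≤ n. -/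
open Finset

namespace NEkSN

variable {n : ℕ}

theorem choose_cross (m N r : ℕ) (h : m ≤ N) :
    m.choose (r + 1) * N.choose r ≤ m.choose r * N.choose (r + 1) := by
  have h1 := Nat.choose_succ_right_eq m r
  have h2 := Nat.choose_succ_right_eq N r
  refine Nat.le_of_mul_le_mul_right (c := r + 1) ?_ (Nat.succ_pos r)
  calc m.choose (r + 1) * N.choose r * (r + 1)
      = m.choose (r + 1) * (r + 1) * N.choose r := by ring
    _ = m.choose r * N.choose r * (m - r) := by rw [h1]; ring
    _ ≤ m.choose r * N.choose r * (N - r) := Nat.mul_le_mul_left _ (by omega)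
    _ = m.choose r * (N.choose (r + 1) * (r + 1)) := by rw [h2]; ring
    _ = m.choose r * N.choose (r + 1) * (r + 1) := by ring

theorem lam_den_pos {n k : ℕ} (hn : 2 ≤ n) (hk2 : k ≤ n) :
    (0 : ℝ) < n * ((n - 1).choose (k - 1) : ℝ) := by
  have h1 : 0 < (n - 1).choose (k - 1) := Nat.choose_pos (by omega)
  have h2 : 0 < n := by omega
  positivity

theorem lam_empty {n k : ℕ} (hn : 2 ≤ n) (hk2 : k ≤ n) :
    lam k (∅ : Finset (Fin n × Fin n)) = 1 := by
  have h := lam_den_pos hn hk2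
  unfold lam
  rw [div_eq_one_iff_eq h.ne']
  simp [linkedSet]

theorem lam_anti {n k : ℕ} (hn : 2 ≤ n) (hk2 : k ≤ n) {I I' : Finset (Fin n × Fin n)}
    (h : I ⊆ I') : lam k I' ≤ lam k I := by
  unfold lam
  refine div_le_div_of_nonneg_right ?_ (lam_den_pos hn hk2).le
  calc _ ≤ ∑ i ∈ univ.filter (fun i : Fin n => (i, i) ∉ I'),
      ((n - 1 - (linkedSet I i).card).choose (k - 1) : ℝ) := by
        refine Finset.sum_le_sum fun i _ => ?_
        have hc : (linkedSet I i).card ≤ (linkedSet I' i).card := by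
          refine Finset.card_le_card fun j hj => ?_
          simp only [linkedSet, mem_filter, mem_univ, true_and] at hj ⊢
          exact ⟨hj.1, hj.2.imp (fun a => h a) (fun a => h a)⟩
        exact_mod_cast Nat.choose_le_choose _ (by omega)
    _ ≤ _ := by
        refine Finset.sum_le_sum_of_subset_of_nonneg (fun i hi => ?_) (fun _ _ _ => by positivity)
        simp only [mem_filter, mem_univ, true_and] at hi ⊢
        exact fun a => hi (h a)

theorem lam_succ {n k : ℕ} (hn : 2 ≤ n) (hk1 : 1 < k) (hk2 : k + 1 ≤ n)
    (I : Finset (Fin n × Fin n)) : lam (k + 1) I ≤ lam k I := by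
  have p1 := lam_den_pos (k := k + 1) hn hk2
  have p2 := lam_den_pos (k := k) hn (by omega)
  unfold lam
  rw [div_le_div_iff₀ p1 p2, Finset.sum_mul, Finset.sum_mul]
  refine Finset.sum_le_sum fun i _ => ?_
  obtain ⟨r, rfl⟩ : ∃ r, k = r + 1 := ⟨k - 1, by omega⟩
  simp only [Nat.add_sub_cancel]
  have := choose_cross (n - 1 - (linkedSet I i).card) (n - 1) r (by omega)
  have := Nat.mul_le_mul_left n this
  have h : ((n * ((n - 1 - (linkedSet I i).card).choose (r + 1) * (n - 1).choose r) : ℕ) : ℝ) ≤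
      ((n * ((n - 1 - (linkedSet I i).card).choose r * (n - 1).choose (r + 1)) : ℕ) : ℝ) :=
    Nat.cast_le.mpr this
  simp only [Nat.cast_mul] at h
  linarith

/-- monotonicity of the eigenvalues `λ_{k,I}`: `λ_{k,∅} = 1`,
`0 ≤ λ_{k,I} ≤ 1`, `λ` is antitone in `I`, and weakly decreasing in `k` on `2 ≤ k ≤ n`. -/
theorem lam_monotone {n : ℕ} (hn : 2 ≤ n) (k : ℕ) (hk1 : 1 < k) (hk2 : k ≤ n)
    (I I' : Finset (Fin n × Fin n))
    (hI : ∀ p ∈ I, p.2 ≤ p.1) (hI' : ∀ p ∈ I', p.2 ≤ p.1) :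
    lam k (∅ : Finset (Fin n × Fin n)) = 1 ∧
    (0 ≤ lam k I ∧ lam k I ≤ 1) ∧
    (I ⊆ I' → lam k I' ≤ lam k I) ∧
    (∀ k' : ℕ, k ≤ k' → k' ≤ n → lam k' I ≤ lam k I) := by
  refine ⟨lam_empty hn hk2, ⟨?_, ?_⟩, fun h => lam_anti hn hk2 h, ?_⟩
  · unfold lam
    positivity
  · rw [← lam_empty hn hk2]
    exact lam_anti hn hk2 (Finset.empty_subset I)
  · intro k' hkk
    induction k', hkk using Nat.le_induction with
    | base => exact fun _ => le_rfl
    | succ m hm ih =>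
      exact fun h => (lam_succ hn (by omega) h I).trans (ih (by omega))

end NEkSN
end
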